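/- Fix a positive integer k and positive integers b₁, …, b_k. The sum of triangular numbers f(x₁,…,x_k) = Σ_{i=1}^{k} b_i · t_{x_i} (with x_i ∈ ℕ) represents every positive integer if and only if it represents each of 1, 2, 4, 5, and 8. -/

import Mathlib

/-- The `k`-th triangular number. -/
def triangular (k : ℕ) : ℕ := k * (k + 1) / 2

/-- The ternary quadratic form `ax² + by² + cz² + ryz + sxz + txy`. -/
def ternaryForm (a b c r s t x y z : ℤ) : ℤ :=
  a * x ^ 2 + b * y ^ 2 + c * z ^ 2 + r * y * z + s * x * z + t * x * y

/-- The half-discriminant of `ternaryForm a b c r s t`. -/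
def ternaryDisc (a b c r s t : ℤ) : ℤ :=
  4 * a * b * c + r * s * t - a * r ^ 2 - b * s ^ 2 - c * t ^ 2

/-- The reduced forms reached by the descent in `ternaryForm_induction`. -/
structure IsReducedTernary (a b c r s t : ℤ) : Prop where
  pos : 0 < a
  abs_t : |t| ≤ a
  abs_s : |s| ≤ a
  le : a ≤ b
  minor_pos : 0 < 4 * a * b - t ^ 2
  minor_le : 4 * a * b - t ^ 2 ≤ 4 * a * c - s ^ 2
  abs_minor : |2 * (2 * a * r - s * t)| ≤ 4 * a * b - t ^ 2

lemma exists_abs_two_mul_add_mul_le (u : ℤ) {m : ℤ} (hm : 0 < m) :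
    ∃ k : ℤ, |2 * (u + k * m)| ≤ m := by
  have h1 := Int.emod_add_mul_ediv u m
  have h2 := Int.emod_nonneg u hm.ne'
  have h3 := Int.emod_lt_of_pos u hm
  by_cases h : 2 * (u % m) ≤ m
  · refine ⟨-(u / m), ?_⟩
    rw [abs_le]; constructor <;> linarith
  · refine ⟨-(u / m) - 1, ?_⟩
    rw [abs_le]; constructor <;> linarith

/-- A property of integers that holds for all values of reduced forms holds for all values of
positive definite forms of the same discriminant. -/
theorem ternaryForm_induction {D : ℤ} (hD : 0 < D) (P : ℤ → Prop)
    (hP : ∀ a b c r s t, IsReducedTernary a b c r s t → ternaryDisc a b c r s t = D →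
      ∀ x y z, P (ternaryForm a b c r s t x y z)) :
    ∀ a b c r s t : ℤ, 0 < a → 0 < 4 * a * b - t ^ 2 → ternaryDisc a b c r s t = D →
      ∀ x y z, P (ternaryForm a b c r s t x y z) := by
  suffices H : ∀ m k : ℕ, ∀ a b c r s t : ℤ, a.toNat = m → (4 * a * b - t ^ 2).toNat = k →
      0 < a → 0 < 4 * a * b - t ^ 2 → ternaryDisc a b c r s t = D →
      ∀ x y z, P (ternaryForm a b c r s t x y z) from
    fun a b c r s t => H _ _ a b c r s t rfl rfl
  intro m
  induction m using Nat.strong_induction_on with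
  | _ m ihm =>
  intro k
  induction k using Nat.strong_induction_on with
  | _ k ihk =>
  intro a b c r s t hm hk ha hA hd
  obtain ⟨l, hl⟩ := exists_abs_two_mul_add_mul_le (2 * a * r - s * t) hA
  suffices H : ∀ c r s : ℤ, ternaryDisc a b c r s t = D →
      |2 * (2 * a * r - s * t)| ≤ 4 * a * b - t ^ 2 →
      ∀ x y z, P (ternaryForm a b c r s t x y z) by
    intro x y z
    have := H (c + b * l ^ 2 + r * l) (r + 2 * b * l) (s + t * l)
      (by rw [← hd]; unfold ternaryDisc; ring) (by convert hl using 2; ring) x (y - l * z) z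
    convert this using 1
    unfold ternaryForm; ring
  clear hl l hd c r s
  intro c r s hd hB
  have key : (4 * a * b - t ^ 2) * (4 * a * c - s ^ 2) = 4 * a * D + (2 * a * r - s * t) ^ 2 := by
    rw [← hd]; unfold ternaryDisc; ring
  have hC : 0 < 4 * a * c - s ^ 2 := by
    have : 0 < 4 * a * D := by positivity
    exact pos_of_mul_pos_right (by rw [key]; positivity) hA.le
  by_cases hCA : 4 * a * c - s ^ 2 < 4 * a * b - t ^ 2
  · intro x y z
    have := ihk (4 * a * c - s ^ 2).toNat (by omega) a c b r t s hm rfl ha hC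
      (by rw [← hd]; unfold ternaryDisc; ring) x z y
    convert this using 1
    unfold ternaryForm; ring
  push Not at hCA
  have h2a : 0 < 2 * a := by linarith
  obtain ⟨l, hl⟩ := exists_abs_two_mul_add_mul_le t h2a
  suffices H : ∀ b r t : ℤ, ternaryDisc a b c r s t = D → |t| ≤ a → 0 < 4 * a * b - t ^ 2 →
      4 * a * b - t ^ 2 ≤ 4 * a * c - s ^ 2 → |2 * (2 * a * r - s * t)| ≤ 4 * a * b - t ^ 2 →
      ∀ x y z, P (ternaryForm a b c r s t x y z) by
    have e : 4 * a * (b + a * l ^ 2 + t * l) - (t + l * (2 * a)) ^ 2 = 4 * a * b - t ^ 2 := by ring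
    intro x y z
    have := H (b + a * l ^ 2 + t * l) (r + s * l) (t + l * (2 * a))
      (by rw [← hd]; unfold ternaryDisc; ring)
      (by rw [abs_mul, abs_two] at hl; linarith) (by rwa [e]) (by rwa [e])
      (by rw [e]; convert hB using 2; ring) (x - l * y) y z
    convert this using 1
    unfold ternaryForm; ring
  clear hl l hd hA hB hCA hk ihk key b r t
  intro b r t hd ht hA hCA hB
  by_cases hba : b < a
  · intro x y z
    have hb : 0 < b := by
      have : 0 < 4 * a * b := by nlinarith
      exact pos_of_mul_pos_right this (by linarith)
    have := ihm b.toNat (by omega) _ b a c s r t rfl rfl hb (by linarith)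
      (by rw [← hd]; unfold ternaryDisc; ring) y x z
    convert this using 1
    unfold ternaryForm; ring
  push Not at hba
  obtain ⟨l, hl⟩ := exists_abs_two_mul_add_mul_le s h2a
  have e : 4 * a * (c + a * l ^ 2 + s * l) - (s + l * (2 * a)) ^ 2 = 4 * a * c - s ^ 2 := by ring
  intro x y z
  have := hP a b (c + a * l ^ 2 + s * l) (r + t * l) (s + l * (2 * a)) t
    ⟨ha, ht, by rw [abs_mul, abs_two] at hl; linarith, hba, hA, by rwa [e],
      by convert hB using 2; ring⟩
    (by rw [← hd]; unfold ternaryDisc; ring) (x - l * z) y z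
  convert this using 1
  unfold ternaryForm; ring

lemma IsReducedTernary.eq_one {a b c r s t : ℤ} (h : IsReducedTernary a b c r s t)
    (hD : ternaryDisc a b c r s t ≤ 4) :
    a = 1 ∧ b = 1 ∧ c = 1 := by
  obtain ⟨ha, ht, hs, hab, hA, hAC, hB⟩ := h
  have key : (4 * a * b - t ^ 2) * (4 * a * c - s ^ 2) =
      4 * a * ternaryDisc a b c r s t + (2 * a * r - s * t) ^ 2 := by
    unfold ternaryDisc; ring
  have ht2 : t ^ 2 ≤ a ^ 2 := sq_le_sq' (by linarith [abs_le.1 ht]) (by linarith [abs_le.1 ht])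
  have hs2 : s ^ 2 ≤ a ^ 2 := sq_le_sq' (by linarith [abs_le.1 hs]) (by linarith [abs_le.1 hs])
  have hB2 : (2 * (2 * a * r - s * t)) ^ 2 ≤ (4 * a * b - t ^ 2) ^ 2 :=
    sq_le_sq' (by linarith [abs_le.1 hB]) (by linarith [abs_le.1 hB])
  have hAa : 3 * a ^ 2 ≤ 4 * a * b - t ^ 2 := by nlinarith
  have haD : 4 * a * ternaryDisc a b c r s t ≤ 4 * a * 4 := by gcongr
  have hA2 : 3 * (4 * a * b - t ^ 2) ^ 2 ≤ 64 * a := by nlinarith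
  have ha1 : a = 1 := by
    have h9 : (3 * a ^ 2) ^ 2 ≤ (4 * a * b - t ^ 2) ^ 2 := by gcongr
    by_contra hne
    have h2 : 2 ≤ a := by omega
    have : a * 8 ≤ a * a ^ 3 := by gcongr; nlinarith [mul_self_nonneg (a - 2)]
    nlinarith
  subst ha1
  have hA4 : 4 * 1 * b - t ^ 2 ≤ 4 := by nlinarith
  have hb : b = 1 := by nlinarith
  subst hb
  refine ⟨rfl, rfl, ?_⟩
  have hC : 3 * (4 * 1 * c - s ^ 2) ≤ 20 := by nlinarith
  have : c ≤ 1 := by linarith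
  have : 0 < c := by nlinarith
  omega
lemma IsReducedTernary.bounds {a b c r s t : ℤ} (h : IsReducedTernary a b c r s t)
    (hD : ternaryDisc a b c r s t ≤ 4) :
    a = 1 ∧ b = 1 ∧ c = 1 ∧ (-1 ≤ r ∧ r ≤ 1) ∧ (-1 ≤ s ∧ s ≤ 1) ∧ (-1 ≤ t ∧ t ≤ 1) := by
  obtain ⟨rfl, rfl, rfl⟩ := h.eq_one hD
  have hs := abs_le.1 h.abs_s
  have ht := abs_le.1 h.abs_t
  have hB := abs_le.1 h.abs_minor
  refine ⟨rfl, rfl, rfl, ?_, hs, ht⟩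
  obtain ⟨hs1, hs2⟩ := hs
  obtain ⟨ht1, ht2⟩ := ht
  interval_cases s <;> interval_cases t <;> omega

/-- Positive definite ternary forms of half-discriminant `4` represent sums of three squares. -/
theorem ternaryForm_eq_sum_three_sq {a b c r s t : ℤ} (ha : 0 < a) (hA : 0 < 4 * a * b - t ^ 2)
    (hD : ternaryDisc a b c r s t = 4) (x y z : ℤ) :
    ∃ u v w : ℤ, ternaryForm a b c r s t x y z = u ^ 2 + v ^ 2 + w ^ 2 := by
  refine ternaryForm_induction (by norm_num) (fun n => ∃ u v w : ℤ, n = u ^ 2 + v ^ 2 + w ^ 2)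
    ?_ a b c r s t ha hA hD x y z
  clear ha hA hD a b c r s t x y z
  intro a b c r s t h hD x y z
  have hB := abs_le.1 h.abs_minor
  have hAC := h.minor_le
  obtain ⟨rfl, rfl, rfl, ⟨hr1, hr2⟩, ⟨hs1, hs2⟩, ht1, ht2⟩ := h.bounds hD.le
  unfold ternaryDisc at hD
  refine ⟨x, y, z, ?_⟩
  unfold ternaryForm
  interval_cases r <;> interval_cases s <;> interval_cases t <;> omega

/-- Positive definite ternary forms of half-discriminant `3` represent values of
`u² + uv + v² + w²`. -/
theorem ternaryForm_eq_eisenstein_add_sq {a b c r s t : ℤ} (ha : 0 < a)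
    (hA : 0 < 4 * a * b - t ^ 2) (hD : ternaryDisc a b c r s t = 3) (x y z : ℤ) :
    ∃ u v w : ℤ, ternaryForm a b c r s t x y z = u ^ 2 + u * v + v ^ 2 + w ^ 2 := by
  refine ternaryForm_induction (by norm_num)
    (fun n => ∃ u v w : ℤ, n = u ^ 2 + u * v + v ^ 2 + w ^ 2) ?_ a b c r s t ha hA hD x y z
  clear ha hA hD a b c r s t x y z
  intro a b c r s t h hD x y z
  have hB := abs_le.1 h.abs_minor
  have hAC := h.minor_le
  obtain ⟨rfl, rfl, rfl, ⟨hr1, hr2⟩, ⟨hs1, hs2⟩, ht1, ht2⟩ := h.bounds (by omega)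
  unfold ternaryDisc at hD
  have hcase : (r = 0 ∧ s = 0 ∧ t ^ 2 = 1) ∨ (s = 0 ∧ t = 0 ∧ r ^ 2 = 1) ∨
      (r = 0 ∧ t = 0 ∧ s ^ 2 = 1) := by
    interval_cases r <;> interval_cases s <;> interval_cases t <;> omega
  unfold ternaryForm
  obtain ⟨rfl, rfl, h1⟩ | ⟨rfl, rfl, h1⟩ | ⟨rfl, rfl, h1⟩ := hcase
  · exact ⟨x, t * y, z, by linear_combination -y ^ 2 * h1⟩
  · exact ⟨y, r * z, x, by linear_combination -z ^ 2 * h1⟩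
  · exact ⟨x, s * z, y, by linear_combination -z ^ 2 * h1⟩

lemma sum_three_sq_of_dvd {n d τ : ℤ} (hd : 0 < d) (hb : 0 < n * d - 1)
    (h : n * d - 1 ∣ τ ^ 2 + d) : ∃ u v w : ℤ, n = u ^ 2 + v ^ 2 + w ^ 2 := by
  obtain ⟨a, ha⟩ := h
  have ha0 : 0 < a := by
    have : 0 < (n * d - 1) * a := by rw [← ha]; positivity
    exact pos_of_mul_pos_right this hb.le
  have := ternaryForm_eq_sum_three_sq (a := a) (b := n * d - 1) (c := n) (r := 0) (s := 2)
    (t := 2 * τ) ha0 (by nlinarith) (by unfold ternaryDisc; linear_combination -4 * n * ha) 0 0 1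
  simpa [ternaryForm] using this

lemma eisenstein_add_sq_of_dvd {n e τ : ℤ} (he : 0 < e) (hb : 0 < 4 * n * e - 3)
    (h : 4 * n * e - 3 ∣ τ ^ 2 + e) : ∃ u v w : ℤ, n = u ^ 2 + u * v + v ^ 2 + w ^ 2 := by
  obtain ⟨a, ha⟩ := h
  have ha0 : 0 < a := by
    have : 0 < (4 * n * e - 3) * a := by rw [← ha]; positivity
    exact pos_of_mul_pos_right this hb.le
  have := ternaryForm_eq_eisenstein_add_sq (a := a) (b := 4 * n * e - 3) (c := n) (r := 0) (s := 1)
    (t := 2 * τ) ha0 (by nlinarith) (by unfold ternaryDisc; linear_combination -4 * n * ha) 0 0 1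
  simpa [ternaryForm] using this

lemma exists_dvd_sq_add_of_jacobiSym {p d : ℕ} (hp : p.Prime) (h : jacobiSym (-d) p = 1) :
    ∃ τ : ℤ, (p : ℤ) ∣ τ ^ 2 + d := by
  have := Fact.mk hp
  rw [← jacobiSym.legendreSym.to_jacobiSym] at h
  have h0 : ((-d : ℤ) : ZMod p) ≠ 0 := by
    intro h0
    rw [(legendreSym.eq_zero_iff p _).2 h0] at h
    exact zero_ne_one h
  obtain ⟨y, hy⟩ := (legendreSym.eq_one_iff p h0).1 h
  obtain ⟨τ, rfl⟩ := ZMod.intCast_surjective y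
  refine ⟨τ, ?_⟩
  rw [← ZMod.intCast_zmod_eq_zero_iff_dvd]
  push_cast at hy ⊢
  linear_combination -hy

lemma jacobiSym_mul_sub (n c : ℤ) (d : ℕ) : jacobiSym (n * d - c) d = jacobiSym (-c) d :=
  jacobiSym.mod_left' (by rw [sub_eq_neg_add, Int.add_mul_emod_self_right])

lemma jacobiSym_neg_of_one_mod_four {p d : ℕ} (hp : p % 4 = 1) (hd : Odd d) :
    jacobiSym (-d) p = jacobiSym p d := by
  rw [jacobiSym.neg _ (Nat.odd_iff.2 (by omega)), ZMod.χ₄_nat_one_mod_four hp, one_mul,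
    jacobiSym.quadratic_reciprocity_one_mod_four' hd hp]

lemma jacobiSym_neg_of_three_mod_four {p d : ℕ} (hp : p % 4 = 3) (hd : d % 4 = 3) :
    jacobiSym (-d) p = jacobiSym p d := by
  rw [jacobiSym.neg _ (Nat.odd_iff.2 (by omega)), ZMod.χ₄_nat_three_mod_four hp,
    jacobiSym.quadratic_reciprocity_three_mod_four hd hp]
  ring

lemma exists_prime_eq_mul_add {q a : ℕ} (hq : q ≠ 0) (h : a.Coprime q) :
    ∃ p j : ℕ, p.Prime ∧ a < p ∧ p = q * j + a := by
  obtain ⟨p, hap, hp, hpa⟩ := Nat.forall_exists_prime_gt_and_modEq a hq h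
  obtain ⟨j, hj⟩ := (Nat.modEq_iff_dvd' hap.le).1 hpa.symm
  exact ⟨p, j, hp, hap, by omega⟩

lemma sum_three_sq_of_two_mod_four {n : ℕ} (hn : n % 4 = 2) :
    ∃ u v w : ℤ, (n : ℤ) = u ^ 2 + v ^ 2 + w ^ 2 := by
  have hco : (n - 1).Coprime (4 * n) := by
    refine Nat.Coprime.mul_right ?_ ?_
    · exact (Nat.coprime_two_right.2 (Nat.odd_iff.2 (by omega))).pow_right 2
    · exact (Nat.coprime_self_sub_left (by omega)).2 (Nat.coprime_one_left n)
  obtain ⟨p, j, hp, -, hpj⟩ := exists_prime_eq_mul_add (by omega) hco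
  have hpd : (p : ℤ) = n * (4 * j + 1 : ℕ) - 1 := by
    rw [hpj]; push_cast [Nat.cast_sub (show 1 ≤ n by omega)]; ring
  have hp4 : p % 4 = 1 := by
    rw [hpj, mul_assoc]; omega
  have hd : Odd (4 * j + 1) := ⟨2 * j, by ring⟩
  have hJ : jacobiSym (-(4 * j + 1 : ℕ)) p = 1 := by
    rw [jacobiSym_neg_of_one_mod_four hp4 hd, hpd,
      jacobiSym_mul_sub,
      jacobiSym.at_neg_one hd, ZMod.χ₄_nat_one_mod_four (by omega)]
  obtain ⟨τ, hτ⟩ := exists_dvd_sq_add_of_jacobiSym hp hJ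
  rw [hpd] at hτ
  exact sum_three_sq_of_dvd (by positivity) (by rw [← hpd]; exact_mod_cast hp.pos) hτ

lemma sum_three_sq_of_odd {n p d : ℕ} (hp : p.Prime) (hpo : Odd p) (hd : Odd d)
    (hpd : 2 * (p : ℤ) = n * d - 1) (hJ : jacobiSym (-d) p = 1) :
    ∃ u v w : ℤ, (n : ℤ) = u ^ 2 + v ^ 2 + w ^ 2 := by
  obtain ⟨τ, hτ⟩ := exists_dvd_sq_add_of_jacobiSym hp hJ
  obtain ⟨σ, hσ, hσp⟩ : ∃ σ : ℤ, Odd σ ∧ (p : ℤ) ∣ σ ^ 2 + d := by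
    rcases Int.even_or_odd τ with h | h
    · refine ⟨τ + p, h.add_odd (by exact_mod_cast hpo), ?_⟩
      have : (τ + p) ^ 2 + d = (τ ^ 2 + d) + p * (2 * τ + p) := by ring
      rw [this]
      exact hτ.add (dvd_mul_right _ _)
    · exact ⟨τ, h, hτ⟩
  have h2 : (2 : ℤ) ∣ σ ^ 2 + d := (hσ.pow.add_odd (by exact_mod_cast hd)).two_dvd
  have hco : IsCoprime (2 : ℤ) p := by
    rw [Int.isCoprime_iff_gcd_eq_one]
    exact_mod_cast Nat.coprime_two_left.2 hpo
  have := hco.mul_dvd h2 hσp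
  rw [hpd] at this
  refine sum_three_sq_of_dvd (by exact_mod_cast hd.pos) ?_ this
  rw [← hpd]
  exact_mod_cast Nat.mul_pos two_pos hp.pos

lemma coprime_of_two_mul_add_one {n c m : ℕ} (hm : Odd m) (h : 2 * m + 1 = c * n) :
    m.Coprime (4 * n) := by
  refine Nat.Coprime.mul_right ((Nat.coprime_two_right.2 hm).pow_right 2) ?_
  refine Nat.Coprime.coprime_mul_left_right (k := c) ?_
  rw [← h]
  simp

lemma sum_three_sq_of_three_mod_eight {n : ℕ} (hn : n % 8 = 3) :
    ∃ u v w : ℤ, (n : ℤ) = u ^ 2 + v ^ 2 + w ^ 2 := by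
  obtain ⟨k, rfl⟩ : ∃ k, n = 8 * k + 3 := ⟨n / 8, by omega⟩
  obtain ⟨p, j, hp, -, hpj⟩ := exists_prime_eq_mul_add (by omega)
    (coprime_of_two_mul_add_one (n := 8 * k + 3) (c := 1) (m := 4 * k + 1)
      ⟨2 * k, by ring⟩ (by ring))
  have hpd : 2 * (p : ℤ) = (8 * k + 3 : ℕ) * (8 * j + 1 : ℕ) - 1 := by
    rw [hpj]; push_cast; ring
  have hp4 : p % 4 = 1 := by
    rw [hpj, mul_assoc]; omega
  have hd : Odd (8 * j + 1) := ⟨4 * j, by ring⟩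
  refine sum_three_sq_of_odd hp (Nat.odd_iff.2 (by omega)) hd hpd ?_
  have h2 : jacobiSym 2 (8 * j + 1) = 1 := by
    rw [jacobiSym.at_two hd, ZMod.χ₈_nat_eq_if_mod_eight]; simp; omega
  have h2p : jacobiSym (2 * p) (8 * j + 1) = 1 := by
    rw [hpd, jacobiSym_mul_sub,
      jacobiSym.at_neg_one hd, ZMod.χ₄_nat_one_mod_four (by omega)]
  rw [jacobiSym_neg_of_one_mod_four hp4 hd]
  rwa [jacobiSym.mul_left, h2, one_mul] at h2p

lemma sum_three_sq_of_one_mod_four {n : ℕ} (hn : n % 4 = 1) :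
    ∃ u v w : ℤ, (n : ℤ) = u ^ 2 + v ^ 2 + w ^ 2 := by
  obtain ⟨k, rfl⟩ : ∃ k, n = 4 * k + 1 := ⟨n / 4, by omega⟩
  obtain ⟨p, j, hp, -, hpj⟩ := exists_prime_eq_mul_add (by omega)
    (coprime_of_two_mul_add_one (n := 4 * k + 1) (c := 3) (m := 6 * k + 1)
      ⟨3 * k, by ring⟩ (by ring))
  have hpd : 2 * (p : ℤ) = (4 * k + 1 : ℕ) * (8 * j + 3 : ℕ) - 1 := by
    rw [hpj]; push_cast; ring
  have hpo : p % 2 = 1 := by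
    rw [hpj, mul_assoc]; omega
  have hd : Odd (8 * j + 3) := ⟨4 * j + 1, by ring⟩
  refine sum_three_sq_of_odd hp (Nat.odd_iff.2 hpo) hd hpd ?_
  have h2 : jacobiSym 2 (8 * j + 3) = -1 := by
    rw [jacobiSym.at_two hd, ZMod.χ₈_nat_eq_if_mod_eight]; simp; omega
  have h2p : jacobiSym (2 * p) (8 * j + 3) = -1 := by
    rw [hpd, jacobiSym_mul_sub,
      jacobiSym.at_neg_one hd, ZMod.χ₄_nat_three_mod_four (by omega)]
  have hpJ : jacobiSym p (8 * j + 3) = 1 := by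
    rw [jacobiSym.mul_left, h2] at h2p
    linarith
  rw [← hpJ]
  rcases Nat.odd_mod_four_iff.1 hpo with h | h
  · exact jacobiSym_neg_of_one_mod_four h hd
  · exact jacobiSym_neg_of_three_mod_four h (by omega)

lemma eisenstein_add_sq_of_not_dvd {n : ℕ} (hn : ¬ 3 ∣ n) :
    ∃ u v w : ℤ, (n : ℤ) = u ^ 2 + u * v + v ^ 2 + w ^ 2 := by
  have hn0 : 1 ≤ n := by omega
  have h3 : Nat.Coprime 3 (4 * n) :=
    Nat.Coprime.mul_right (by norm_num) ((Nat.Prime.coprime_iff_not_dvd Nat.prime_three).2 hn)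
  have h3' : (4 * n - 3).Coprime 3 := (Nat.coprime_sub_self_left (by omega)).2 h3.symm
  have hco : (4 * n - 3).Coprime (48 * n) := by
    refine Nat.Coprime.mul_right (k := 4 * n - 3) (m := 48) (n := n) ?_ ?_
    · exact Nat.Coprime.mul_right (k := 4 * n - 3) (m := 2 ^ 4) (n := 3)
        ((Nat.coprime_two_right.2 (Nat.odd_iff.2 (by omega))).pow_right 4) h3'
    · refine Nat.Coprime.coprime_mul_left_right (k := 4) ?_
      have := Nat.coprime_add_self_right.2 h3'
      rwa [Nat.add_sub_of_le (by omega)] at this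
  obtain ⟨p, j, hp, -, hpj⟩ := exists_prime_eq_mul_add (by omega) hco
  have hpd : (p : ℤ) = 4 * n * (12 * j + 1 : ℕ) - 3 := by
    rw [hpj]; push_cast [Nat.cast_sub (show 3 ≤ 4 * n by omega)]; ring
  have hp4 : p % 4 = 1 := by
    rw [hpj, mul_assoc]; omega
  have hd : Odd (12 * j + 1) := ⟨6 * j, by ring⟩
  have hJ : jacobiSym (-(12 * j + 1 : ℕ)) p = 1 := by
    rw [jacobiSym_neg_of_one_mod_four hp4 hd, hpd,
      jacobiSym_mul_sub, ← Nat.cast_ofNat (n := 3),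
      jacobiSym_neg_of_one_mod_four (by omega) (by decide),
      jacobiSym.mod_left' (b := 3) (a₂ := 1) (by push_cast; omega), jacobiSym.one_left]
  obtain ⟨τ, hτ⟩ := exists_dvd_sq_add_of_jacobiSym hp hJ
  rw [hpd] at hτ
  exact eisenstein_add_sq_of_dvd (by positivity) (by rw [← hpd]; exact_mod_cast hp.pos) hτ

lemma two_mul_triangular (k : ℕ) : 2 * triangular k = k * (k + 1) :=
  Nat.two_mul_div_two_of_even (Nat.even_mul_succ_self k)

lemma triangular_three_mul_add_one (k : ℕ) : triangular (3 * k + 1) = 9 * triangular k + 1 := by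
  have h1 := two_mul_triangular (3 * k + 1)
  have h2 := two_mul_triangular k
  linarith

lemma exists_triangular_of_odd {x : ℤ} (hx : x % 2 = 1) :
    ∃ k : ℕ, x ^ 2 = 8 * (triangular k : ℤ) + 1 := by
  have H : ∀ m : ℕ, (2 * (m : ℤ) + 1) ^ 2 = 8 * (triangular m : ℤ) + 1 := fun m => by
    have : 2 * (triangular m : ℤ) = m * (m + 1) := by exact_mod_cast two_mul_triangular m
    linear_combination -4 * this
  refine ⟨x.natAbs / 2, ?_⟩
  rw [← H, ← Int.natAbs_sq]
  congr 1
  omega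

/-- Every natural number is of the form `a t_x + b t_y + c t_z`. -/
def UniversalTernary (a b c : ℕ) : Prop :=
  ∀ n : ℕ, ∃ x y z : ℕ, a * triangular x + b * triangular y + c * triangular z = n

/-- Every natural number is of the form `a t_x + b t_y + c t_z + d t_w`. -/
def UniversalQuaternary (a b c d : ℕ) : Prop :=
  ∀ n : ℕ, ∃ x y z w : ℕ,
    a * triangular x + b * triangular y + c * triangular z + d * triangular w = n

lemma exists_triangular_of_odd_squares {a b c n : ℕ} {x y z : ℤ}
    (hx : x % 2 = 1) (hy : y % 2 = 1) (hz : z % 2 = 1)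
    (h : 8 * n + a + b + c = a * x ^ 2 + b * y ^ 2 + c * z ^ 2) :
    ∃ x y z : ℕ, a * triangular x + b * triangular y + c * triangular z = n := by
  obtain ⟨i, hi⟩ := exists_triangular_of_odd hx
  obtain ⟨j, hj⟩ := exists_triangular_of_odd hy
  obtain ⟨k, hk⟩ := exists_triangular_of_odd hz
  refine ⟨i, j, k, ?_⟩
  rw [hi, hj, hk] at h
  zify
  linarith

lemma sq_emod_sixteen (x : ℤ) :
    (x % 2 = 1 ∧ x ^ 2 % 8 = 1) ∨ (x % 4 = 0 ∧ x ^ 2 % 16 = 0) ∨ (x % 4 = 2 ∧ x ^ 2 % 16 = 4) := by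
  have h : x % 16 = 0 ∨ x % 16 = 1 ∨ x % 16 = 2 ∨ x % 16 = 3 ∨ x % 16 = 4 ∨ x % 16 = 5 ∨
      x % 16 = 6 ∨ x % 16 = 7 ∨ x % 16 = 8 ∨ x % 16 = 9 ∨ x % 16 = 10 ∨ x % 16 = 11 ∨
      x % 16 = 12 ∨ x % 16 = 13 ∨ x % 16 = 14 ∨ x % 16 = 15 := by omega
  have h2 : x ^ 2 % 16 = (x % 16) ^ 2 % 16 := by simp [pow_two, Int.mul_emod]
  rcases h with h | h | h | h | h | h | h | h | h | h | h | h | h | h | h | h <;>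
    rw [h] at h2 <;> omega

lemma exists_odd_sq_add_three_mul_sq {y z : ℤ} (h : (y ^ 2 + 3 * z ^ 2) % 8 = 4) :
    ∃ u v : ℤ, u % 2 = 1 ∧ v % 2 = 1 ∧ y ^ 2 + 3 * z ^ 2 = u ^ 2 + 3 * v ^ 2 := by
  have hy := sq_emod_sixteen y
  have hz := sq_emod_sixteen z
  by_cases hy1 : y % 2 = 1
  · exact ⟨y, z, hy1, by omega, rfl⟩
  · obtain ⟨u, rfl⟩ : (2 : ℤ) ∣ y := by omega
    obtain ⟨v, rfl⟩ : (2 : ℤ) ∣ z := by omega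
    exact ⟨u + 3 * v, u - v, by omega, by omega, by ring⟩

/-- A sum of three squares congruent to `2` modulo `4` has exactly one even term. -/
lemma exists_odd_odd_even {n : ℕ} (hn : n % 4 = 2) :
    ∃ u v w : ℤ, u % 2 = 1 ∧ v % 2 = 1 ∧ w % 2 = 0 ∧ (n : ℤ) = u ^ 2 + v ^ 2 + w ^ 2 := by
  obtain ⟨u, v, w, h⟩ := sum_three_sq_of_two_mod_four hn
  have hu := sq_emod_sixteen u
  have hv := sq_emod_sixteen v
  have hw := sq_emod_sixteen w
  by_cases hu1 : u % 2 = 0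
  · exact ⟨v, w, u, by omega, by omega, hu1, by omega⟩
  by_cases hv1 : v % 2 = 0
  · exact ⟨w, u, v, by omega, by omega, hv1, by omega⟩
  · exact ⟨u, v, w, by omega, by omega, by omega, h⟩

theorem universal_one_one_one : UniversalTernary 1 1 1 := by
  intro n
  obtain ⟨u, v, w, h⟩ := sum_three_sq_of_three_mod_eight (n := 8 * n + 3) (by omega)
  have hu := sq_emod_sixteen u
  have hv := sq_emod_sixteen v
  have hw := sq_emod_sixteen w
  push_cast at h
  exact exists_triangular_of_odd_squares (x := u) (y := v) (z := w) (by omega) (by omega) (by omega)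
    (by push_cast; linarith)

theorem universal_one_one_two : UniversalTernary 1 1 2 := by
  intro n
  obtain ⟨u, v, w, hu, hv, hw, h⟩ := exists_odd_odd_even (n := 4 * n + 2) (by omega)
  push_cast at h
  exact exists_triangular_of_odd_squares (x := u + w) (y := u - w) (z := v)
    (by omega) (by omega) hv (by push_cast; linear_combination 2 * h)

theorem universal_one_one_four : UniversalTernary 1 1 4 := by
  intro n
  obtain ⟨u, v, w, hu, hv, hw, h⟩ := exists_odd_odd_even (n := 8 * n + 6) (by omega)
  have hu' := sq_emod_sixteen u
  have hv' := sq_emod_sixteen v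
  have hw' := sq_emod_sixteen w
  push_cast at h
  obtain ⟨k, rfl⟩ : (2 : ℤ) ∣ w := by omega
  exact exists_triangular_of_odd_squares (x := u) (y := v) (z := k)
    hu hv (by omega) (by push_cast; linear_combination h)

theorem universal_one_two_two : UniversalTernary 1 2 2 := by
  intro n
  obtain ⟨u, v, w, h⟩ := sum_three_sq_of_one_mod_four (n := 8 * n + 5) (by omega)
  have hu := sq_emod_sixteen u
  have hv := sq_emod_sixteen v
  have hw := sq_emod_sixteen w
  push_cast at h
  obtain ⟨a, b, c, ha, hb, hbc, habc⟩ : ∃ a b c : ℤ, a % 2 = 1 ∧ b % 2 = 0 ∧ (b + c) % 4 = 2 ∧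
      8 * (n : ℤ) + 5 = a ^ 2 + b ^ 2 + c ^ 2 := by
    by_cases hu1 : u % 2 = 1
    · exact ⟨u, v, w, hu1, by omega, by omega, h⟩
    by_cases hv1 : v % 2 = 1
    · exact ⟨v, w, u, hv1, by omega, by omega, by linarith⟩
    · exact ⟨w, u, v, by omega, by omega, by omega, by linarith⟩
  obtain ⟨y, rfl⟩ : (2 : ℤ) ∣ b := by omega
  obtain ⟨z, rfl⟩ : (2 : ℤ) ∣ c := by omega
  exact exists_triangular_of_odd_squares (x := a) (y := y + z) (z := y - z)
    ha (by omega) (by omega) (by push_cast; linear_combination habc)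

theorem universal_one_two_four : UniversalTernary 1 2 4 := by
  intro n
  obtain ⟨u, v, w, hu, hv, hw, h⟩ := exists_odd_odd_even (n := 16 * n + 14) (by omega)
  push_cast at h
  obtain ⟨y, rfl⟩ : (2 : ℤ) ∣ w := by omega
  obtain ⟨a, ha⟩ : (2 : ℤ) ∣ u + v := by omega
  obtain ⟨b, hb⟩ : (2 : ℤ) ∣ u - v := by omega
  obtain rfl : u = a + b := by omega
  obtain rfl : v = a - b := by omega
  have h' : 8 * (n : ℤ) + 7 = a ^ 2 + b ^ 2 + 2 * y ^ 2 := by linarith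
  have ha' := sq_emod_sixteen a
  have hb' := sq_emod_sixteen b
  have hy' := sq_emod_sixteen y
  obtain ⟨x, z, hx, hz, hy, hxz⟩ : ∃ x z : ℤ, x % 2 = 1 ∧ z % 2 = 1 ∧ y % 2 = 1 ∧
      a ^ 2 + b ^ 2 = x ^ 2 + 4 * z ^ 2 := by
    by_cases ha1 : a % 2 = 1
    · obtain ⟨z, rfl⟩ : (2 : ℤ) ∣ b := by omega
      exact ⟨a, z, ha1, by omega, by omega, by ring⟩
    · obtain ⟨z, rfl⟩ : (2 : ℤ) ∣ a := by omega
      exact ⟨b, z, by omega, by omega, by omega, by ring⟩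
  exact exists_triangular_of_odd_squares (x := x) (y := y) (z := z)
    hx hy hz (by push_cast; linarith)

lemma sq_emod_five (x : ℤ) : (x % 5 = 0 ∧ x ^ 2 % 5 = 0) ∨
    ((x % 5 = 1 ∨ x % 5 = 4) ∧ x ^ 2 % 5 = 1) ∨ ((x % 5 = 2 ∨ x % 5 = 3) ∧ x ^ 2 % 5 = 4) := by
  have h : x % 5 = 0 ∨ x % 5 = 1 ∨ x % 5 = 2 ∨ x % 5 = 3 ∨ x % 5 = 4 := by omega
  have h2 : x ^ 2 % 5 = (x % 5) ^ 2 % 5 := by simp [pow_two, Int.mul_emod]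
  rcases h with h | h | h | h | h <;> rw [h] at h2 <;> omega

theorem universal_one_one_five : UniversalTernary 1 1 5 := by
  intro n
  obtain ⟨u, v, w, h⟩ := sum_three_sq_of_three_mod_eight (n := 5 * (8 * n + 7)) (by omega)
  have hu := sq_emod_sixteen u
  have hv := sq_emod_sixteen v
  have hw := sq_emod_sixteen w
  push_cast at h
  obtain ⟨hu2, hv2, hw2⟩ : u % 2 = 1 ∧ v % 2 = 1 ∧ w % 2 = 1 := by omega
  clear hu hv hw
  have hu5 := sq_emod_five u
  have hv5 := sq_emod_five v
  have hw5 := sq_emod_five w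
  obtain ⟨a, b, c, hc, habc⟩ : ∃ a b c : ℤ, c % 2 = 1 ∧
      5 * (8 * (n : ℤ) + 7) = a ^ 2 + b ^ 2 + (5 * c) ^ 2 := by
    by_cases hu1 : u % 5 = 0
    · obtain ⟨c, rfl⟩ := Int.dvd_of_emod_eq_zero hu1
      exact ⟨v, w, c, by omega, by linarith⟩
    by_cases hv1 : v % 5 = 0
    · obtain ⟨c, rfl⟩ := Int.dvd_of_emod_eq_zero hv1
      exact ⟨u, w, c, by omega, by linarith⟩
    · obtain ⟨c, rfl⟩ : (5 : ℤ) ∣ w := by omega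
      exact ⟨u, v, c, by omega, by linarith⟩
  have ha5 := sq_emod_five a
  have hb5 := sq_emod_five b
  have hab5 : (a ^ 2 + b ^ 2) % 5 = 0 := by
    have : a ^ 2 + b ^ 2 = 5 * (8 * n + 7 - 5 * c ^ 2) := by linear_combination -habc
    omega
  clear hu5 hv5 hw5 h
  obtain ⟨k, hk⟩ : ∃ k : ℤ, b ^ 2 = (2 * a + 5 * k) ^ 2 := by
    by_cases hab : (b - 2 * a) % 5 = 0
    · obtain ⟨k, hk⟩ := Int.dvd_of_emod_eq_zero hab
      exact ⟨k, by rw [← hk]; ring⟩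
    · obtain ⟨k, hk⟩ : (5 : ℤ) ∣ -b - 2 * a := by
        have : a % 5 = 0 ∨ a % 5 = 1 ∨ a % 5 = 2 ∨ a % 5 = 3 ∨ a % 5 = 4 := by omega
        rcases this with h | h | h | h | h <;> omega
      exact ⟨k, by rw [← hk]; ring⟩
  have h' : 8 * (n : ℤ) + 7 = (a + 2 * k) ^ 2 + k ^ 2 + 5 * c ^ 2 := by linarith
  clear habc ha5 hb5 hab5 hk
  have hx := sq_emod_sixteen (a + 2 * k)
  have hy := sq_emod_sixteen k
  have hz := sq_emod_sixteen c
  exact exists_triangular_of_odd_squares (x := a + 2 * k) (y := k) (z := c)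
    (by omega) (by omega) (by omega) (by push_cast; linarith)

lemma sq_emod_three (x : ℤ) : (x % 3 = 0 ∧ x ^ 2 % 3 = 0) ∨ (x % 3 ≠ 0 ∧ x ^ 2 % 3 = 1) := by
  have h : x % 3 = 0 ∨ x % 3 = 1 ∨ x % 3 = 2 := by omega
  have h2 : x ^ 2 % 3 = (x % 3) ^ 2 % 3 := by simp [pow_two, Int.mul_emod]
  rcases h with h | h | h <;> rw [h] at h2 <;> omega

lemma exists_sq_eq_add_three_mul_sq {a b : ℤ} (h : a % 3 = 0 ↔ b % 3 = 0) :
    ∃ k : ℤ, b ^ 2 = (a + 3 * k) ^ 2 := by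
  by_cases hab : (b - a) % 3 = 0
  · obtain ⟨k, hk⟩ := Int.dvd_of_emod_eq_zero hab
    exact ⟨k, by rw [← hk]; ring⟩
  · obtain ⟨k, hk⟩ : (3 : ℤ) ∣ -b - a := by
      have : a % 3 = 0 ∨ a % 3 = 1 ∨ a % 3 = 2 := by omega
      rcases this with h | h | h <;> omega
    exact ⟨k, by rw [← hk]; ring⟩

theorem universal_one_two_three : UniversalTernary 1 2 3 := by
  intro n
  obtain ⟨a, b, c, h⟩ := sum_three_sq_of_one_mod_four (n := 12 * n + 9) (by omega)
  have ha := sq_emod_three a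
  have hb := sq_emod_three b
  have hc := sq_emod_three c
  push_cast at h
  obtain ⟨p, hp⟩ := exists_sq_eq_add_three_mul_sq (a := a) (b := b) (by omega)
  obtain ⟨q, hq⟩ := exists_sq_eq_add_three_mul_sq (a := a) (b := c) (by omega)
  have h' : 8 * (n : ℤ) + 6 = 2 * (a + p + q) ^ 2 + ((2 * p - q) ^ 2 + 3 * q ^ 2) := by
    linarith
  have hy := sq_emod_sixteen (a + p + q)
  have hx := sq_emod_sixteen (2 * p - q)
  have hz := sq_emod_sixteen q
  obtain ⟨x, z, hx1, hz1, hxz⟩ :=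
    exists_odd_sq_add_three_mul_sq (y := 2 * p - q) (z := q) (by omega)
  exact exists_triangular_of_odd_squares (x := x) (y := a + p + q) (z := z)
    hx1 (by omega) hz1 (by push_cast; linarith)

lemma exists_sq_add_three_mul_sq (u v : ℤ) :
    ∃ x y : ℤ, u ^ 2 + u * v + v ^ 2 = x ^ 2 + 3 * y ^ 2 := by
  rcases Int.even_or_odd' u with ⟨k, rfl | rfl⟩
  · exact ⟨k + v, k, by ring⟩
  rcases Int.even_or_odd' v with ⟨l, rfl | rfl⟩
  · exact ⟨l + (2 * k + 1), l, by ring⟩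
  · exact ⟨k - l, k + l + 1, by ring⟩

lemma exists_triangular_one_one_three {n : ℕ} (hn : n % 3 ≠ 2) :
    ∃ x y z : ℕ, 1 * triangular x + 1 * triangular y + 3 * triangular z = n := by
  obtain ⟨u, v, w, h⟩ := eisenstein_add_sq_of_not_dvd (n := 8 * n + 5) (by omega)
  push_cast at h
  obtain ⟨x, y, hxy⟩ := exists_sq_add_three_mul_sq u v
  rw [hxy] at h
  have hx := sq_emod_sixteen x
  have hy := sq_emod_sixteen y
  have hw := sq_emod_sixteen w
  by_cases hx1 : x % 2 = 1
  · obtain ⟨i, j, hi, hj, hij⟩ := exists_odd_sq_add_three_mul_sq (y := w) (z := y) (by omega)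
    exact exists_triangular_of_odd_squares hx1 hi hj (by push_cast; linarith)
  · obtain ⟨i, j, hi, hj, hij⟩ := exists_odd_sq_add_three_mul_sq (y := x) (z := y) (by omega)
    exact exists_triangular_of_odd_squares (x := w) (by omega) hi hj (by push_cast; linarith)

theorem universal_one_one_three_three : UniversalQuaternary 1 1 3 3 := by
  intro n
  induction n using Nat.strong_induction_on with
  | _ n ih =>
  by_cases hn : n % 3 = 2
  · obtain ⟨x, y, z, w, h⟩ := ih (n / 3) (by omega)
    refine ⟨3 * z + 1, 3 * w + 1, x, y, ?_⟩
    rw [triangular_three_mul_add_one, triangular_three_mul_add_one]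
    omega
  · obtain ⟨x, y, z, h⟩ := exists_triangular_one_one_three hn
    exact ⟨x, y, z, 0, h⟩

theorem universal_one_one_three_six : UniversalQuaternary 1 1 3 6 := by
  intro n
  by_cases hn : n % 3 = 2
  · obtain ⟨x, y, z, h⟩ := universal_one_two_three (n / 3)
    refine ⟨3 * z + 1, 1, x, y, ?_⟩
    rw [triangular_three_mul_add_one, show triangular 1 = 1 from rfl]
    omega
  · obtain ⟨x, y, z, h⟩ := exists_triangular_one_one_three hn
    exact ⟨x, y, z, 0, h⟩

lemma universal_one_one_three_of_lt {d : ℕ} (hd : d % 3 ≠ 0) (hd' : d ≤ 8) :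
    UniversalQuaternary 1 1 3 d := by
  intro n
  by_cases hn : n % 3 = 2
  · by_cases hnd : d ≤ n
    · obtain ⟨x, y, z, h⟩ := exists_triangular_one_one_three (n := n - d) (by omega)
      refine ⟨x, y, z, 1, ?_⟩
      rw [h, show triangular 1 = 1 from rfl]
      omega
    · obtain rfl | rfl : n = 2 ∨ n = 5 := by omega
      · exact ⟨1, 1, 0, 0, by simp [triangular]⟩
      · exact ⟨1, 1, 1, 0, by simp [triangular]⟩
  · obtain ⟨x, y, z, h⟩ := exists_triangular_one_one_three hn
    exact ⟨x, y, z, 0, h⟩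

lemma exists_sum_of_subset {ι : Type*} [Fintype ι] (b : ι → ℕ) (S : Finset ι) {n : ℕ}
    (h : ∃ x : ι → ℕ, ∑ i ∈ S, b i * triangular (x i) = n) :
    ∃ x : ι → ℕ, ∑ i, b i * triangular (x i) = n := by
  classical
  obtain ⟨x, rfl⟩ := h
  refine ⟨fun i => if i ∈ S then x i else 0, ?_⟩
  rw [← Finset.sum_subset (Finset.subset_univ S)]
  · exact Finset.sum_congr rfl fun i hi => by simp [hi]
  · intro i _ hi
    simp [hi, triangular]

lemma UniversalTernary.exists_sum {ι : Type*} [Fintype ι] {b : ι → ℕ} {i j l : ι}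
    (h : UniversalTernary (b i) (b j) (b l)) (hij : i ≠ j) (hil : i ≠ l) (hjl : j ≠ l) (n : ℕ) :
    ∃ x : ι → ℕ, ∑ i, b i * triangular (x i) = n := by
  classical
  obtain ⟨x, y, z, hn⟩ := h n
  refine exists_sum_of_subset b {i, j, l} ⟨fun m => if m = i then x else if m = j then y else z, ?_⟩
  rw [Finset.sum_insert (by simp [*]), Finset.sum_insert (by simp [*]), Finset.sum_singleton]
  simp [hij.symm, hil.symm, hjl.symm, ← add_assoc, hn]

lemma UniversalQuaternary.exists_sum {ι : Type*} [Fintype ι] {b : ι → ℕ} {i j l m : ι}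
    (h : UniversalQuaternary (b i) (b j) (b l) (b m)) (hij : i ≠ j) (hil : i ≠ l) (hjl : j ≠ l)
    (him : i ≠ m) (hjm : j ≠ m) (hlm : l ≠ m) (n : ℕ) :
    ∃ x : ι → ℕ, ∑ i, b i * triangular (x i) = n := by
  classical
  obtain ⟨x, y, z, w, hn⟩ := h n
  refine exists_sum_of_subset b {i, j, l, m}
    ⟨fun m => if m = i then x else if m = j then y else if m = l then z else w, ?_⟩
  rw [Finset.sum_insert (by simp [*]), Finset.sum_insert (by simp [*]),
    Finset.sum_insert (by simp [*]), Finset.sum_singleton]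
  simp [hij.symm, hil.symm, hjl.symm, him.symm, hjm.symm, hlm.symm, ← add_assoc, hn]

/-- If the partial sum over `S` misses `n`, a representation of `n` uses a coefficient outside `S`
that is at most `n`. -/
lemma exists_notMem_le {ι : Type*} [Fintype ι] {b : ι → ℕ} {n : ℕ}
    (h : ∃ x : ι → ℕ, ∑ i, b i * triangular (x i) = n) (S : Finset ι)
    (hS : ∀ x : ι → ℕ, ∑ i ∈ S, b i * triangular (x i) ≠ n) : ∃ j ∉ S, b j ≤ n := by
  obtain ⟨x, hx⟩ := h
  by_contra! hc
  refine hS x ((Finset.sum_subset (Finset.subset_univ S) fun i _ hi => ?_).trans hx)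
  have hle : b i * triangular (x i) ≤ n :=
    hx ▸ Finset.single_le_sum (f := fun i => b i * triangular (x i))
      (fun _ _ => Nat.zero_le _) (Finset.mem_univ i)
  by_contra h0
  have := Nat.le_mul_of_pos_right (b i) (Nat.pos_of_ne_zero (right_ne_zero_of_mul h0))
  exact absurd (this.trans hle) (hc i hi).not_ge

lemma triangular_mem_of_le_nine {k : ℕ} (h : triangular k ≤ 9) :
    triangular k = 0 ∨ triangular k = 1 ∨ triangular k = 3 ∨ triangular k = 6 := by
  have hk : k ≤ 3 := by
    by_contra! hk
    nlinarith [two_mul_triangular k]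
  interval_cases k <;> simp [triangular]

/-- Kane's theorem: a sum of triangular numbers `Σ bᵢ t_{xᵢ}` represents every
positive integer iff it represents `1, 2, 4, 5` and `8`. -/
theorem universal_sum_of_triangular_iff (k : ℕ) (hk : 0 < k)
    (b : Fin k → ℕ) (hb : ∀ i, 0 < b i) :
    (∀ n : ℕ, 0 < n → ∃ x : Fin k → ℕ, ∑ i, b i * triangular (x i) = n) ↔
      (∀ n ∈ ({1, 2, 4, 5, 8} : Set ℕ),
        ∃ x : Fin k → ℕ, ∑ i, b i * triangular (x i) = n) := by
  refine ⟨fun h n hn => h n ?_, fun h n _ => ?_⟩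
  · rcases hn with rfl | rfl | rfl | rfl | rfl <;> norm_num
  obtain ⟨i, -, hi⟩ := exists_notMem_le (h 1 (by simp)) ∅ (by simp)
  have hi1 : b i = 1 := le_antisymm hi (hb i)
  obtain ⟨j, hj, hj2⟩ := exists_notMem_le (h 2 (by simp)) {i} (fun x hx => by
    rw [Finset.sum_singleton, hi1] at hx
    have := triangular_mem_of_le_nine (k := x i) (by omega)
    omega)
  have hij : i ≠ j := by rintro rfl; simp at hj
  have hj0 := hb j
  obtain hj1 | hj1 : b j = 1 ∨ b j = 2 := by omega
  · obtain ⟨l, hl, hl5⟩ := exists_notMem_le (h 5 (by simp)) {i, j} (fun x hx => by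
      rw [Finset.sum_pair hij, hi1, hj1] at hx
      have := triangular_mem_of_le_nine (k := x i) (by omega)
      have := triangular_mem_of_le_nine (k := x j) (by omega)
      omega)
    simp only [Finset.mem_insert, Finset.mem_singleton, not_or] at hl
    have hil : i ≠ l := Ne.symm hl.1
    have hjl : j ≠ l := Ne.symm hl.2
    have hT {c : ℕ} {l : Fin k} (hc : UniversalTernary 1 1 c) (hl : b l = c) (hil : i ≠ l)
        (hjl : j ≠ l) : ∃ x : Fin k → ℕ, ∑ i, b i * triangular (x i) = n :=
      UniversalTernary.exists_sum (by rwa [hi1, hj1, hl]) hij hil hjl n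
    have hl0 := hb l
    obtain hl1 | hl1 | hl1 | hl1 | hl1 : b l = 1 ∨ b l = 2 ∨ b l = 3 ∨ b l = 4 ∨ b l = 5 := by omega
    · exact hT universal_one_one_one hl1 hil hjl
    · exact hT universal_one_one_two hl1 hil hjl
    · obtain ⟨m, hm, hm8⟩ := exists_notMem_le (h 8 (by simp)) {i, j, l} (fun x hx => by
        rw [Finset.sum_insert (by simp [hij, hil]), Finset.sum_pair hjl, hi1, hj1, hl1] at hx
        have := triangular_mem_of_le_nine (k := x i) (by omega)
        have := triangular_mem_of_le_nine (k := x j) (by omega)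
        have := triangular_mem_of_le_nine (k := x l) (by omega)
        omega)
      simp only [Finset.mem_insert, Finset.mem_singleton, not_or] at hm
      have hQ (hc : UniversalQuaternary 1 1 3 (b m)) :
          ∃ x : Fin k → ℕ, ∑ i, b i * triangular (x i) = n :=
        UniversalQuaternary.exists_sum (by rwa [hi1, hj1, hl1]) hij hil hjl
          (Ne.symm hm.1) (Ne.symm hm.2.1) (Ne.symm hm.2.2) n
      have hm0 := hb m
      by_cases hm3 : b m % 3 = 0
      · obtain hm1 | hm1 : b m = 3 ∨ b m = 6 := by omega
        · exact hQ (hm1 ▸ universal_one_one_three_three)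
        · exact hQ (hm1 ▸ universal_one_one_three_six)
      · exact hQ (universal_one_one_three_of_lt hm3 hm8)
    · exact hT universal_one_one_four hl1 hil hjl
    · exact hT universal_one_one_five hl1 hil hjl
  · obtain ⟨l, hl, hl4⟩ := exists_notMem_le (h 4 (by simp)) {i, j} (fun x hx => by
      rw [Finset.sum_pair hij, hi1, hj1] at hx
      have := triangular_mem_of_le_nine (k := x i) (by omega)
      have := triangular_mem_of_le_nine (k := x j) (by omega)
      omega)
    simp only [Finset.mem_insert, Finset.mem_singleton, not_or] at hl
    have hil : i ≠ l := Ne.symm hl.1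
    have hjl : j ≠ l := Ne.symm hl.2
    have hT {c : ℕ} (hc : UniversalTernary 1 2 c) (hl : b l = c) :
        ∃ x : Fin k → ℕ, ∑ i, b i * triangular (x i) = n :=
      UniversalTernary.exists_sum (by rwa [hi1, hj1, hl]) hij hil hjl n
    have hl0 := hb l
    obtain hl1 | hl1 | hl1 | hl1 : b l = 1 ∨ b l = 2 ∨ b l = 3 ∨ b l = 4 := by omega
    · exact UniversalTernary.exists_sum (i := i) (j := l) (l := j)
        (by rw [hi1, hl1, hj1]; exact universal_one_one_two) hil hij hjl.symm n
    · exact hT universal_one_two_two hl1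
    · exact hT universal_one_two_three hl1
    · exact hT universal_one_two_four hl1
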